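/- arXiv:2507.19504 — 3 statements merged into one kernel-verified Lean document; each statement's English description precedes it below -/
import Mathlib

section
/- Persistent Hodge theorem: the kernel of the persistent Laplacian L is linearly isomorphic to the persistent homology quotient (ker ∂₁ ∩ A₁) ⧸ ((range ∂₂) ∩ A₁); in particular finrank(ker L) = finrank(ker ∂₁ ∩ A₁) − finrank((range ∂₂) ∩ A₁), the persistent Betti number. -/
open scoped RealInnerProductSpace

section PersistentSetup

variable {B₂ B₁ B₀ : Type*}
  [NormedAddCommGroup B₂] [InnerProductSpace ℝ B₂] [FiniteDimensional ℝ B₂]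
  [NormedAddCommGroup B₁] [InnerProductSpace ℝ B₁] [FiniteDimensional ℝ B₁]
  [NormedAddCommGroup B₀] [InnerProductSpace ℝ B₀] [FiniteDimensional ℝ B₀]

/-- The persistent boundary operator `∂' : C' → A₁`, where `C' = ∂₂⁻¹(A₁)`,
obtained by restricting `∂₂`. -/
def persistentBoundary (dTwo : B₂ →ₗ[ℝ] B₁) (A₁ : Submodule ℝ B₁) :
    ↥(A₁.comap dTwo) →ₗ[ℝ] ↥A₁ :=
  dTwo.restrict fun _ hx => hx

/-- The restriction `δ : A₁ → A₀` of `∂₁`. -/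
def restrictedBoundary (dOne : B₁ →ₗ[ℝ] B₀) (A₁ : Submodule ℝ B₁)
    (A₀ : Submodule ℝ B₀) (hA : ∀ x ∈ A₁, dOne x ∈ A₀) : ↥A₁ →ₗ[ℝ] ↥A₀ :=
  dOne.restrict hA

/-- The persistent Laplacian `L = ∂' ∘ ∂'† + δ† ∘ δ : A₁ → A₁`. -/
noncomputable def persistentLaplacian (dTwo : B₂ →ₗ[ℝ] B₁) (dOne : B₁ →ₗ[ℝ] B₀)
    (A₁ : Submodule ℝ B₁) (A₀ : Submodule ℝ B₀) (hA : ∀ x ∈ A₁, dOne x ∈ A₀) :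
    ↥A₁ →ₗ[ℝ] ↥A₁ :=
  persistentBoundary dTwo A₁ ∘ₗ LinearMap.adjoint (persistentBoundary dTwo A₁)
    + LinearMap.adjoint (restrictedBoundary dOne A₁ A₀ hA)
        ∘ₗ restrictedBoundary dOne A₁ A₀ hA

/-- Persistent Hodge theorem: `ker L` is linearly isomorphic to the persistent
homology quotient `(ker ∂₁ ∩ A₁) ⧸ ((range ∂₂) ∩ A₁)`, and
`dim ker L = dim (ker ∂₁ ∩ A₁) − dim ((range ∂₂) ∩ A₁)`, the
persistent Betti number. -/
theorem persistentLaplacian_hodge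
    (dTwo : B₂ →ₗ[ℝ] B₁) (dOne : B₁ →ₗ[ℝ] B₀) (hc : dOne ∘ₗ dTwo = 0)
    (A₁ : Submodule ℝ B₁) (A₀ : Submodule ℝ B₀) (hA : ∀ x ∈ A₁, dOne x ∈ A₀) :
    Nonempty (↥(LinearMap.ker (persistentLaplacian dTwo dOne A₁ A₀ hA)) ≃ₗ[ℝ]
      (↥(LinearMap.ker dOne ⊓ A₁) ⧸
        Submodule.comap (LinearMap.ker dOne ⊓ A₁).subtype
          (LinearMap.range dTwo ⊓ A₁))) ∧
    Module.finrank ℝ ↥(LinearMap.ker (persistentLaplacian dTwo dOne A₁ A₀ hA))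
      = Module.finrank ℝ ↥(LinearMap.ker dOne ⊓ A₁)
        - Module.finrank ℝ ↥(LinearMap.range dTwo ⊓ A₁) := by
  have hker : LinearMap.ker (persistentLaplacian dTwo dOne A₁ A₀ hA)
      = (LinearMap.range (persistentBoundary dTwo A₁))ᗮ
        ⊓ LinearMap.ker (restrictedBoundary dOne A₁ A₀ hA) := by
    ext x
    rw [Submodule.mem_inf, LinearMap.orthogonal_range, LinearMap.mem_ker, LinearMap.mem_ker,
      LinearMap.mem_ker]
    constructor
    · intro h
      have h2 : inner ℝ (persistentLaplacian dTwo dOne A₁ A₀ hA x) x = 0 := by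
        rw [h, inner_zero_left]
      rw [persistentLaplacian, LinearMap.add_apply, LinearMap.comp_apply, LinearMap.comp_apply,
        inner_add_left, LinearMap.adjoint_inner_left, ← LinearMap.adjoint_inner_right] at h2
      rw [real_inner_self_eq_norm_sq, real_inner_self_eq_norm_sq] at h2
      constructor
      · rw [← norm_eq_zero, ← sq_eq_zero_iff]
        nlinarith [sq_nonneg ‖LinearMap.adjoint (persistentBoundary dTwo A₁) x‖,
          sq_nonneg ‖restrictedBoundary dOne A₁ A₀ hA x‖]
      · rw [← norm_eq_zero, ← sq_eq_zero_iff]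
        nlinarith [sq_nonneg ‖LinearMap.adjoint (persistentBoundary dTwo A₁) x‖,
          sq_nonneg ‖restrictedBoundary dOne A₁ A₀ hA x‖]
    · rintro ⟨h1, h2⟩
      rw [persistentLaplacian, LinearMap.add_apply, LinearMap.comp_apply, LinearMap.comp_apply,
        h1, h2, map_zero, map_zero, add_zero]
  have hd : ∀ y, dOne (dTwo y) = 0 := fun y => LinearMap.congr_fun hc y
  have hle : LinearMap.range (persistentBoundary dTwo A₁)
      ≤ LinearMap.ker (restrictedBoundary dOne A₁ A₀ hA) := by
    rintro _ ⟨y, rfl⟩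
    exact Subtype.ext (hd y)
  have hr : (LinearMap.range (persistentBoundary dTwo A₁)).map A₁.subtype
      = LinearMap.range dTwo ⊓ A₁ := by
    ext x
    constructor
    · rintro ⟨_, ⟨y, rfl⟩, rfl⟩
      exact ⟨⟨y, rfl⟩, y.2⟩
    · rintro ⟨⟨y, rfl⟩, hy⟩
      exact ⟨_, ⟨⟨y, hy⟩, rfl⟩, rfl⟩
  have hk : (LinearMap.ker (restrictedBoundary dOne A₁ A₀ hA)).map A₁.subtype
      = LinearMap.ker dOne ⊓ A₁ := by
    ext x
    constructor
    · rintro ⟨y, hy, rfl⟩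
      exact ⟨congrArg Subtype.val hy, y.2⟩
    · rintro ⟨h1, h2⟩
      exact ⟨⟨x, h2⟩, Subtype.ext h1, rfl⟩
  have hfr := Submodule.finrank_map_subtype_eq A₁ (LinearMap.range (persistentBoundary dTwo A₁))
  have hfk := Submodule.finrank_map_subtype_eq A₁
    (LinearMap.ker (restrictedBoundary dOne A₁ A₀ hA))
  rw [hr] at hfr
  rw [hk] at hfk
  have hsum := Submodule.finrank_add_inf_finrank_orthogonal hle
  rw [← hker, ← hfr, ← hfk] at hsum
  have hle2 : LinearMap.range dTwo ⊓ A₁ ≤ LinearMap.ker dOne ⊓ A₁ := by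
    rintro _ ⟨⟨y, rfl⟩, hy⟩
    exact ⟨hd y, hy⟩
  have hq := Submodule.finrank_quotient_add_finrank
    (Submodule.comap (LinearMap.ker dOne ⊓ A₁).subtype (LinearMap.range dTwo ⊓ A₁))
  have he := (Submodule.comapSubtypeEquivOfLe hle2).finrank_eq
  refine ⟨⟨LinearEquiv.ofFinrankEq _ _ ?_⟩, ?_⟩
  · have he' : Module.finrank ℝ ↥(Submodule.comap (LinearMap.ker dOne ⊓ A₁).subtype
        (LinearMap.range dTwo ⊓ A₁)) = Module.finrank ℝ ↥(LinearMap.range dTwo ⊓ A₁) := he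
    omega
  · omega

end PersistentSetup
end

section
/- Persistent Hodge decomposition: the space A₁ is the internal direct sum of the three subspaces range ∂', ker L, and range δ†, and these three subspaces are pairwise orthogonal with respect to the induced inner product on A₁. -/
open scoped RealInnerProductSpace

section PersistentSetup

variable {B₂ B₁ B₀ : Type*}
  [NormedAddCommGroup B₂] [InnerProductSpace ℝ B₂] [FiniteDimensional ℝ B₂]
  [NormedAddCommGroup B₁] [InnerProductSpace ℝ B₁] [FiniteDimensional ℝ B₁]
  [NormedAddCommGroup B₀] [InnerProductSpace ℝ B₀] [FiniteDimensional ℝ B₀]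

/-- Persistent Hodge decomposition: `A₁` is the internal direct sum of
`range ∂'`, `ker L`, and `range δ†`, which are pairwise orthogonal for the
induced inner product on `A₁`. -/
theorem persistentLaplacian_hodgeDecomposition
    (dTwo : B₂ →ₗ[ℝ] B₁) (dOne : B₁ →ₗ[ℝ] B₀) (hc : dOne ∘ₗ dTwo = 0)
    (A₁ : Submodule ℝ B₁) (A₀ : Submodule ℝ B₀) (hA : ∀ x ∈ A₁, dOne x ∈ A₀) :
    DirectSum.IsInternal
      (![LinearMap.range (persistentBoundary dTwo A₁),
         LinearMap.ker (persistentLaplacian dTwo dOne A₁ A₀ hA),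
         LinearMap.range (LinearMap.adjoint (restrictedBoundary dOne A₁ A₀ hA))]
        : Fin 3 → Submodule ℝ ↥A₁) ∧
    (∀ x ∈ LinearMap.range (persistentBoundary dTwo A₁),
      ∀ y ∈ LinearMap.ker (persistentLaplacian dTwo dOne A₁ A₀ hA),
        ⟪x, y⟫ = 0) ∧
    (∀ x ∈ LinearMap.range (persistentBoundary dTwo A₁),
      ∀ y ∈ LinearMap.range (LinearMap.adjoint (restrictedBoundary dOne A₁ A₀ hA)),
        ⟪x, y⟫ = 0) ∧
    (∀ x ∈ LinearMap.ker (persistentLaplacian dTwo dOne A₁ A₀ hA),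
      ∀ y ∈ LinearMap.range (LinearMap.adjoint (restrictedBoundary dOne A₁ A₀ hA)),
        ⟪x, y⟫ = 0) := by
  set D := persistentBoundary dTwo A₁ with hD
  set E := restrictedBoundary dOne A₁ A₀ hA with hE
  set L := persistentLaplacian dTwo dOne A₁ A₀ hA with hL
  have hED : ∀ c, E (D c) = 0 := by
    intro c
    apply Subtype.ext
    exact LinearMap.congr_fun hc (c : B₂)
  have hLx : ∀ x, L x = D (LinearMap.adjoint D x) + LinearMap.adjoint E (E x) := fun x => rfl
  have hker : ∀ x, L x = 0 → LinearMap.adjoint D x = 0 ∧ E x = 0 := by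
    intro x hx
    have h : ⟪L x, x⟫ = 0 := by rw [hx, inner_zero_left]
    rw [hLx, inner_add_left, LinearMap.adjoint_inner_left,
      ← LinearMap.adjoint_inner_right, real_inner_self_eq_norm_sq,
      real_inner_self_eq_norm_sq] at h
    have h1 := sq_nonneg ‖LinearMap.adjoint D x‖
    have h2 := sq_nonneg ‖E x‖
    constructor
    · rw [← norm_eq_zero, ← sq_eq_zero_iff]; linarith
    · rw [← norm_eq_zero, ← sq_eq_zero_iff]; linarith
  have o1 : ∀ x ∈ LinearMap.range D, ∀ y ∈ LinearMap.ker L, ⟪x, y⟫ = 0 := by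
    rintro _ ⟨c, rfl⟩ y hy
    rw [← LinearMap.adjoint_inner_right, (hker y hy).1, inner_zero_right]
  have o2 : ∀ x ∈ LinearMap.range D, ∀ y ∈ LinearMap.range (LinearMap.adjoint E),
      ⟪x, y⟫ = 0 := by
    rintro _ ⟨c, rfl⟩ _ ⟨w, rfl⟩
    rw [LinearMap.adjoint_inner_right, hED, inner_zero_left]
  have o3 : ∀ x ∈ LinearMap.ker L, ∀ y ∈ LinearMap.range (LinearMap.adjoint E),
      ⟪x, y⟫ = 0 := by
    rintro x hx _ ⟨w, rfl⟩
    rw [LinearMap.adjoint_inner_right, (hker x hx).2, inner_zero_left]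
  refine ⟨?_, o1, o2, o3⟩
  have hof : OrthogonalFamily ℝ
      (fun i => ↥((![LinearMap.range D, LinearMap.ker L,
        LinearMap.range (LinearMap.adjoint E)] : Fin 3 → Submodule ℝ ↥A₁) i))
      (fun i => Submodule.subtypeₗᵢ _) := by
    rintro i j hij ⟨v, hv⟩ ⟨w, hw⟩
    change ⟪v, w⟫ = 0
    fin_cases i <;> fin_cases j
    · exact absurd rfl hij
    · exact o1 v hv w hw
    · exact o2 v hv w hw
    · rw [real_inner_comm]; exact o1 w hw v hv
    · exact absurd rfl hij
    · exact o3 v hv w hw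
    · rw [real_inner_comm]; exact o2 w hw v hv
    · rw [real_inner_comm]; exact o3 w hw v hv
    · exact absurd rfl hij
  rw [hof.isInternal_iff, Submodule.eq_bot_iff]
  intro x hx
  rw [Submodule.mem_orthogonal] at hx
  have hm := fun i => le_iSup (![LinearMap.range D, LinearMap.ker L,
        LinearMap.range (LinearMap.adjoint E)] : Fin 3 → Submodule ℝ ↥A₁) i
  have hDx : LinearMap.adjoint D x = 0 := by
    have h := hx (D (LinearMap.adjoint D x)) (hm 0 ⟨_, rfl⟩)
    rw [← LinearMap.adjoint_inner_right] at h
    exact inner_self_eq_zero.mp h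
  have hEx : E x = 0 := by
    have h := hx (LinearMap.adjoint E (E x)) (hm 2 ⟨_, rfl⟩)
    rw [LinearMap.adjoint_inner_left] at h
    exact inner_self_eq_zero.mp h
  have hk : x ∈ LinearMap.ker L := by
    rw [LinearMap.mem_ker, hLx, hDx, hEx, map_zero, map_zero, add_zero]
  exact inner_self_eq_zero.mp (hx x (hm 1 hk))

end PersistentSetup
end

section
/- Nullity of the persistent Laplacian equals the persistent Betti number: the dimension of the kernel of the persistent Laplacian L equals the rank of the induced homology map f : H_A → H_B, i.e. finrank(ker L) = finrank(range f). -/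
open scoped RealInnerProductSpace

section PersistentSetup

variable {B₂ B₁ B₀ : Type*}
  [NormedAddCommGroup B₂] [InnerProductSpace ℝ B₂] [FiniteDimensional ℝ B₂]
  [NormedAddCommGroup B₁] [InnerProductSpace ℝ B₁] [FiniteDimensional ℝ B₁]
  [NormedAddCommGroup B₀] [InnerProductSpace ℝ B₀] [FiniteDimensional ℝ B₀]

theorem mem_ker_persistentLaplacian (dTwo : B₂ →ₗ[ℝ] B₁) (dOne : B₁ →ₗ[ℝ] B₀)
    (A₁ : Submodule ℝ B₁) (A₀ : Submodule ℝ B₀) (hA : ∀ x ∈ A₁, dOne x ∈ A₀) (x : ↥A₁) :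
    x ∈ LinearMap.ker (persistentLaplacian dTwo dOne A₁ A₀ hA) ↔
      LinearMap.adjoint (persistentBoundary dTwo A₁) x = 0 ∧
      restrictedBoundary dOne A₁ A₀ hA x = 0 := by
  rw [LinearMap.mem_ker]
  constructor
  · intro h
    have h1 : inner ℝ (persistentLaplacian dTwo dOne A₁ A₀ hA x) x = 0 := by
      rw [h, inner_zero_left]
    simp only [persistentLaplacian, LinearMap.add_apply, LinearMap.comp_apply, inner_add_left] at h1
    rw [LinearMap.adjoint_inner_left, ← LinearMap.adjoint_inner_right,
      real_inner_self_eq_norm_sq, real_inner_self_eq_norm_sq] at h1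
    constructor
    · rw [← norm_eq_zero]
      nlinarith [sq_nonneg ‖LinearMap.adjoint (persistentBoundary dTwo A₁) x‖,
        sq_nonneg ‖restrictedBoundary dOne A₁ A₀ hA x‖]
    · rw [← norm_eq_zero]
      nlinarith [sq_nonneg ‖LinearMap.adjoint (persistentBoundary dTwo A₁) x‖,
        sq_nonneg ‖restrictedBoundary dOne A₁ A₀ hA x‖]
  · rintro ⟨h1, h2⟩
    simp [persistentLaplacian, h1, h2]

/-- Nullity of the persistent Laplacian equals the persistent Betti number:
`dim ker L = rank f`, where `f : H_A → H_B` is the homology map induced by the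
inclusion of the subcomplex. -/
theorem persistentLaplacian_nullity_eq_persistentBetti
    (dTwo : B₂ →ₗ[ℝ] B₁) (dOne : B₁ →ₗ[ℝ] B₀) (hc : dOne ∘ₗ dTwo = 0)
    (A₂ : Submodule ℝ B₂) (A₁ : Submodule ℝ B₁) (A₀ : Submodule ℝ B₀)
    (hA₂ : Submodule.map dTwo A₂ ≤ A₁) (hA : ∀ x ∈ A₁, dOne x ∈ A₀) :
    ∃ f : (↥(LinearMap.ker dOne ⊓ A₁) ⧸
            Submodule.comap (LinearMap.ker dOne ⊓ A₁).subtype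
              (Submodule.map dTwo A₂)) →ₗ[ℝ]
          (↥(LinearMap.ker dOne) ⧸
            Submodule.comap (LinearMap.ker dOne).subtype (LinearMap.range dTwo)),
      (∀ z : ↥(LinearMap.ker dOne ⊓ A₁),
        f (Submodule.Quotient.mk z)
          = Submodule.Quotient.mk (Submodule.inclusion inf_le_left z)) ∧
      Module.finrank ℝ ↥(LinearMap.ker (persistentLaplacian dTwo dOne A₁ A₀ hA))
        = Module.finrank ℝ ↥(LinearMap.range f) := by
  have hker : ∀ x : ↥(LinearMap.ker (persistentLaplacian dTwo dOne A₁ A₀ hA)),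
      dOne ((x : ↥A₁) : B₁) = 0 := by
    intro x
    have h := ((mem_ker_persistentLaplacian dTwo dOne A₁ A₀ hA x).1 x.2).2
    exact congrArg Subtype.val h
  let f := Submodule.mapQ
    (Submodule.comap (LinearMap.ker dOne ⊓ A₁).subtype (Submodule.map dTwo A₂))
    (Submodule.comap (LinearMap.ker dOne).subtype (LinearMap.range dTwo))
    (Submodule.inclusion (inf_le_left : LinearMap.ker dOne ⊓ A₁ ≤ LinearMap.ker dOne))
    (by
      rintro z ⟨y, _, hy⟩
      exact ⟨y, hy⟩)
  have hf : ∀ z : ↥(LinearMap.ker dOne ⊓ A₁),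
      f (Submodule.Quotient.mk z)
        = Submodule.Quotient.mk (Submodule.inclusion inf_le_left z) := fun z => rfl
  let j : ↥(LinearMap.ker (persistentLaplacian dTwo dOne A₁ A₀ hA)) →ₗ[ℝ]
      ↥(LinearMap.ker dOne) :=
    (A₁.subtype ∘ₗ (LinearMap.ker (persistentLaplacian dTwo dOne A₁ A₀ hA)).subtype).codRestrict
      (LinearMap.ker dOne) hker
  let g := (Submodule.comap (LinearMap.ker dOne).subtype (LinearMap.range dTwo)).mkQ ∘ₗ j
  refine ⟨f, hf, ?_⟩
  have hg : Function.Injective g := by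
    rw [← LinearMap.ker_eq_bot, LinearMap.ker_eq_bot']
    intro x hx
    have hx' := (Submodule.Quotient.mk_eq_zero _).1 hx
    obtain ⟨y, hy⟩ := hx'
    have hy' : dTwo y = ((x : ↥A₁) : B₁) := hy
    have hyC : y ∈ A₁.comap dTwo := by
      rw [Submodule.mem_comap, hy']
      exact x.1.2
    have h0 : persistentBoundary dTwo A₁ ⟨y, hyC⟩ = (x : ↥A₁) := Subtype.ext hy'
    have h1 := ((mem_ker_persistentLaplacian dTwo dOne A₁ A₀ hA x).1 x.2).1
    have h2 : inner ℝ (x : ↥A₁) (x : ↥A₁) = (0 : ℝ) := by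
      conv_lhs => rw [← h0]
      rw [← LinearMap.adjoint_inner_right, h0, h1, inner_zero_right]
    exact Subtype.ext (inner_self_eq_zero.1 h2)
  have hr : LinearMap.range g = LinearMap.range f := by
    apply le_antisymm
    · rintro _ ⟨x, rfl⟩
      exact ⟨Submodule.Quotient.mk ⟨((x : ↥A₁) : B₁), hker x, x.1.2⟩, rfl⟩
    · rintro _ ⟨q, rfl⟩
      obtain ⟨z, rfl⟩ := Submodule.Quotient.mk_surjective _ q
      obtain ⟨p, ⟨y, hy⟩, w, hw, hz⟩ :=
        (LinearMap.range (persistentBoundary dTwo A₁)).exists_add_mem_mem_orthogonal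
          (⟨z.1, z.2.2⟩ : ↥A₁)
      have hz' : (z : B₁) = dTwo y + w := by
        have := congrArg Subtype.val hz
        rw [← hy] at this
        exact this
      have hdd : dOne (dTwo y) = 0 := LinearMap.congr_fun hc y
      have hw0 : dOne (w : B₁) = 0 := by
        have h3 : dOne (z : B₁) = 0 := z.2.1
        rw [hz', map_add, hdd, zero_add] at h3
        exact h3
      have hwk : w ∈ LinearMap.ker (persistentLaplacian dTwo dOne A₁ A₀ hA) := by
        rw [mem_ker_persistentLaplacian]
        refine ⟨?_, Subtype.ext hw0⟩
        refine ext_inner_left ℝ fun v => ?_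
        rw [LinearMap.adjoint_inner_right, inner_zero_right]
        exact hw _ ⟨v, rfl⟩
      refine ⟨⟨w, hwk⟩, ?_⟩
      rw [hf]
      refine (Submodule.Quotient.eq _).2 ?_
      refine ⟨-(y : B₂), ?_⟩
      change dTwo (-(y : B₂)) = (w : B₁) - (z : B₁)
      rw [hz', map_neg]
      abel
  rw [← hr]
  exact (LinearEquiv.ofInjective g hg).finrank_eq

end PersistentSetup
end
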